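/- There is no affine function v from the set S of (2,2)-box states to the real numbers (i.e. v(tP+(1-t)Q) = t·v(P)+(1-t)·v(Q) for all P,Q ∈ S and t ∈ [0,1]; note S is convex) such that for every P ∈ S one has P(11|xx) ≤ v(P), P(11|yy) ≤ v(P), v(P) ≤ 1 − P(00|xy), and v(P) ≤ 1 − P(00|yx). -/

import Mathlib

namespace BoxWorld

/-- A (2,2)-box assignment: `P a b α β` stands for `P(αβ|ab)`, where the measurement
settings are `a, b ∈ Fin 2` (with `x = 0`, `y = 1`) and the outcomes are `α, β ∈ Fin 2`. -/
abbrev Box : Type := Fin 2 → Fin 2 → Fin 2 → Fin 2 → ℝ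

/-- (P1) positivity, (P2) normalization, (P3) non-signalling. -/
def IsState (P : Box) : Prop :=
  (∀ a b α β, 0 ≤ P a b α β) ∧
  (∀ a b, ∑ α : Fin 2, ∑ β : Fin 2, P a b α β = 1) ∧
  (∀ a b b' α, ∑ β : Fin 2, P a b α β = ∑ β : Fin 2, P a b' α β) ∧
  (∀ a a' b β, ∑ α : Fin 2, P a b α β = ∑ α : Fin 2, P a' b α β)

/-- The set `S` of (2,2)-box states, as a subtype. -/
abbrev State : Type := {P : Box // IsState P}

/-- The convex combination `t·P + (1-t)·Q` of two boxes. -/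
def mix (t : ℝ) (P Q : Box) : Box :=
  fun a b α β => t * P a b α β + (1 - t) * Q a b α β

/-- States are closed under convex combinations. -/
theorem IsState.mix {P Q : Box} (hP : IsState P) (hQ : IsState Q) {t : ℝ} (h0 : 0 ≤ t)
    (h1 : t ≤ 1) : IsState (mix t P Q) := by
  obtain ⟨p1, p2, p3, p4⟩ := hP
  obtain ⟨q1, q2, q3, q4⟩ := hQ
  refine ⟨fun a b α β => ?_, fun a b => ?_, fun a b b' α => ?_, fun a a' b β => ?_⟩
  · have := p1 a b α β
    have := q1 a b α β
    have : 0 ≤ 1 - t := by linarith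
    simp only [BoxWorld.mix]
    positivity
  · simp only [BoxWorld.mix, Finset.sum_add_distrib, ← Finset.mul_sum, p2, q2]
    ring
  · simp only [BoxWorld.mix, Finset.sum_add_distrib, ← Finset.mul_sum, p3 a b b', q3 a b b']
  · simp only [BoxWorld.mix, Finset.sum_add_distrib, ← Finset.mul_sum, p4 a a' b, q4 a a' b]

/-- The deterministic state in which setting `a` yields outcome `f a` on the left and
setting `b` yields outcome `g b` on the right. -/
def deterministic (f g : Fin 2 → Fin 2) : State :=
  ⟨fun a b α β => (if α = f a then 1 else 0) * (if β = g b then 1 else 0), by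
    refine ⟨fun a b α β => ?_, fun a b => ?_, fun a b b' α => ?_, fun a a' b β => ?_⟩
    · positivity
    all_goals simp⟩

theorem deterministic_apply (f g : Fin 2 → Fin 2) (a b α β : Fin 2) :
    (deterministic f g).1 a b α β =
      (if α = f a then 1 else 0) * (if β = g b then 1 else 0) :=
  rfl

/-- If two pairs of states have the same midpoint, an affine functional has the same sum
of values on them. -/
theorem add_eq_add_of_mix_half_eq {v : State → ℝ}
    (hv : ∀ (P Q R : State) (t : ℝ), 0 ≤ t → t ≤ 1 →
      R.1 = mix t P.1 Q.1 → v R = t * v P + (1 - t) * v Q)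
    {P Q P' Q' : State} (h : mix (1 / 2) P.1 Q.1 = mix (1 / 2) P'.1 Q'.1) :
    v P + v Q = v P' + v Q' := by
  let R : State := ⟨_, P.2.mix Q.2 (t := 1 / 2) (by norm_num) (by norm_num)⟩
  have h₁ := hv P Q R (1 / 2) (by norm_num) (by norm_num) rfl
  have h₂ := hv P' Q' R (1 / 2) (by norm_num) (by norm_num) h
  linarith

/-- There is no affine function `v : S → ℝ` such that for every (2,2)-box
state `P` one has `P(11|xx) ≤ v(P)`, `P(11|yy) ≤ v(P)`, `v(P) ≤ 1 − P(00|xy)` and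
`v(P) ≤ 1 − P(00|yx)`. -/
theorem no_affine_upper_bound_functional :
    ¬ ∃ v : State → ℝ,
      (∀ (P Q R : State) (t : ℝ), 0 ≤ t → t ≤ 1 →
          R.1 = mix t P.1 Q.1 → v R = t * v P + (1 - t) * v Q) ∧
      (∀ P : State,
        P.1 0 0 1 1 ≤ v P ∧ P.1 1 1 1 1 ≤ v P ∧
        v P ≤ 1 - P.1 0 1 0 0 ∧ v P ≤ 1 - P.1 1 0 0 0) := by
  rintro ⟨v, hv, hb⟩
  have left_sum : v (deterministic ![1, 1] ![1, 1]) + v (deterministic ![0, 0] ![1, 1]) =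
      v (deterministic ![1, 0] ![1, 1]) + v (deterministic ![0, 1] ![1, 1]) := by
    apply add_eq_add_of_mix_half_eq hv
    funext a b α β
    fin_cases a <;> fin_cases b <;> fin_cases α <;> fin_cases β <;>
      norm_num [mix, deterministic_apply]
  have right_sum : v (deterministic ![0, 0] ![1, 1]) + v (deterministic ![0, 0] ![0, 0]) =
      v (deterministic ![0, 0] ![1, 0]) + v (deterministic ![0, 0] ![0, 1]) := by
    apply add_eq_add_of_mix_half_eq hv
    funext a b α β
    fin_cases a <;> fin_cases b <;> fin_cases α <;> fin_cases β <;>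
      norm_num [mix, deterministic_apply]
  have h₁ := (hb (deterministic ![1, 1] ![1, 1])).2.2.1
  have h₂ := (hb (deterministic ![1, 0] ![1, 1])).1
  have h₃ := (hb (deterministic ![0, 1] ![1, 1])).2.1
  have h₄ := (hb (deterministic ![0, 0] ![0, 0])).1
  have h₅ := (hb (deterministic ![0, 0] ![1, 0])).2.2.1
  have h₆ := (hb (deterministic ![0, 0] ![0, 1])).2.2.2
  simp [deterministic_apply] at h₁ h₂ h₃ h₄ h₅ h₆
  linarith

end BoxWorld
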